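/- arXiv:2301.12288 — 3 statements merged into one kernel-verified Lean document; each statement's English description precedes it below -/
import Mathlib

section
/- Let α > 1 be real, let μ and ν be probability measures on a measurable space Ω, and suppose the Rényi divergence of order α from μ to ν satisfies D_α(μ ‖ ν) ≤ ε. Then for every δ with 0 < δ < 1 and every measurable set R ⊆ Ω, one has μ(R) ≤ e^{ε + log(1/δ)/(α−1)} · ν(R) + δ. -/
open MeasureTheory Real

open scoped Classical in
/-- Rényi divergence of order `α`: `(α-1)⁻¹ · log ∫ (dμ/dν)^α dν`, equal to `⊤`
when `μ` is not absolutely continuous with respect to `ν`. -/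
noncomputable def renyiDiv {Ω : Type*} [MeasurableSpace Ω] (α : ℝ) (μ ν : Measure Ω) : EReal :=
  if μ ≪ ν then ((α - 1)⁻¹ : ℝ) * ENNReal.log (∫⁻ x, (μ.rnDeriv ν x) ^ α ∂ν) else ⊤

namespace ENNReal

lemma le_add_rpow_one_sub_mul_rpow {α : ℝ} (hα : 1 < α) {c : ENNReal} (hc : c ≠ ⊤) (x : ENNReal) :
    x ≤ c + c ^ (1 - α) * x ^ α := by
  rcases le_or_gt x c with h | h
  · exact h.trans le_self_add
  refine le_trans ?_ le_add_self
  rcases eq_or_ne x ⊤ with rfl | hx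
  · have hc' : c ^ (1 - α) ≠ 0 := by
      simp only [ne_eq, ENNReal.rpow_eq_zero_iff, hc, false_and, or_false, not_and]
      intro _; linarith
    rw [ENNReal.top_rpow_of_pos (by linarith), ENNReal.mul_top hc']
  · calc x = x ^ (1 - α) * x ^ α := by
          rw [← ENNReal.rpow_add _ _ h.ne_bot hx, sub_add_cancel, ENNReal.rpow_one]
      _ ≤ c ^ (1 - α) * x ^ α := by
          gcongr ?_ * _
          rw [← neg_sub, ENNReal.rpow_neg, ENNReal.rpow_neg, ENNReal.inv_le_inv]
          exact ENNReal.rpow_le_rpow h.le (by linarith)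

end ENNReal

lemma lintegral_rnDeriv_rpow_le_of_renyiDiv_le {Ω : Type*} [MeasurableSpace Ω] {α ε : ℝ}
    (hα : 1 < α) {μ ν : Measure Ω} (hD : renyiDiv α μ ν ≤ (ε : EReal)) :
    ∫⁻ x, (μ.rnDeriv ν x) ^ α ∂ν ≤ ENNReal.ofReal (Real.exp (ε * (α - 1))) := by
  have hac : μ ≪ ν := by
    by_contra h
    simp [renyiDiv, h] at hD
  have hα' : (0 : EReal) < ((α - 1 : ℝ) : EReal) := by exact_mod_cast sub_pos.2 hα
  rw [renyiDiv, if_pos hac, EReal.coe_inv, ← EReal.div_eq_inv_mul,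
    EReal.div_le_iff_le_mul hα' (EReal.coe_ne_top _), mul_comm, ← EReal.coe_mul] at hD
  rw [← EReal.exp_coe, ← ENNReal.exp_log (∫⁻ x, _ ∂ν)]
  exact EReal.exp_monotone hD

/-- If `D_α(μ ‖ ν) ≤ ε` for `α > 1`, then for every `0 < δ < 1` and measurable `R`,
`μ(R) ≤ e^{ε + log(1/δ)/(α-1)} · ν(R) + δ`. -/
theorem renyi_to_approx_dp {Ω : Type*} [MeasurableSpace Ω] {α ε : ℝ} (hα : 1 < α)
    (μ ν : Measure Ω) [IsProbabilityMeasure μ] [IsProbabilityMeasure ν]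
    (hD : renyiDiv α μ ν ≤ (ε : EReal)) :
    ∀ δ : ℝ, 0 < δ → δ < 1 → ∀ R : Set Ω, MeasurableSet R →
      μ R ≤ ENNReal.ofReal (Real.exp (ε + Real.log (1 / δ) / (α - 1))) * ν R
        + ENNReal.ofReal δ := by
  intro δ hδ _ R _
  have hac : μ ≪ ν := by
    by_contra h
    simp [renyiDiv, h] at hD
  set t := Real.exp (ε + Real.log (1 / δ) / (α - 1)) with ht
  have ht0 : 0 < t := Real.exp_pos _
  have htδ : t ^ (1 - α) * Real.exp (ε * (α - 1)) = δ := by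
    have hα' : α - 1 ≠ 0 := by linarith
    rw [ht, ← Real.exp_mul, ← Real.exp_add, one_div, Real.log_inv]
    convert Real.exp_log hδ using 2
    field_simp
    ring
  calc μ R = ∫⁻ x in R, μ.rnDeriv ν x ∂ν := (Measure.setLIntegral_rnDeriv hac R).symm
    _ ≤ ∫⁻ x in R, (ENNReal.ofReal t + ENNReal.ofReal t ^ (1 - α) * μ.rnDeriv ν x ^ α) ∂ν :=
        lintegral_mono fun x ↦
          ENNReal.le_add_rpow_one_sub_mul_rpow hα ENNReal.ofReal_ne_top _
    _ = ENNReal.ofReal t * ν R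
          + ENNReal.ofReal t ^ (1 - α) * ∫⁻ x in R, μ.rnDeriv ν x ^ α ∂ν := by
        rw [lintegral_add_left measurable_const, setLIntegral_const,
          lintegral_const_mul _ ((Measure.measurable_rnDeriv μ ν).pow_const α)]
    _ ≤ ENNReal.ofReal t * ν R
          + ENNReal.ofReal t ^ (1 - α) * ENNReal.ofReal (Real.exp (ε * (α - 1))) := by
        gcongr
        exact (setLIntegral_le_lintegral _ _).trans
          (lintegral_rnDeriv_rpow_le_of_renyiDiv_le hα hD)
    _ = ENNReal.ofReal t * ν R + ENNReal.ofReal δ := by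
        rw [ENNReal.ofReal_rpow_of_pos ht0, ← ENNReal.ofReal_mul (by positivity), htδ]
end

section
/- Let D be a type of datasets equipped with an adjacency relation ~, let Ω be a measurable space, and let M : D → (probability measures on Ω) be a mechanism. Fix α > 1 and ε ≥ 0, and suppose M satisfies (α, ε)-Rényi differential privacy, i.e., for all D ~ D', D_α(M(D) ‖ M(D')) ≤ ε. Then for every δ with 0 < δ < 1, M satisfies (ε + log(1/δ)/(α−1), δ)-differential privacy: for all D ~ D' and all measurable R ⊆ Ω, M(D)(R) ≤ e^{ε + log(1/δ)/(α−1)} · M(D')(R) + δ. -/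
open MeasureTheory Real

/-- If `a⁻¹ * log x ≤ b` with `a > 0`, then `x ≤ exp (a * b)`. -/
theorem le_ofReal_exp_of_inv_mul_log_le {a b : ℝ} (ha : 0 < a) {x : ENNReal}
    (h : (a⁻¹ : ℝ) * ENNReal.log x ≤ (b : EReal)) : x ≤ ENNReal.ofReal (exp (a * b)) := by
  rw [← EReal.exp_coe, ← ENNReal.log_le_log_iff, EReal.log_exp]
  generalize ENNReal.log x = L at h
  induction L with
  | bot => exact bot_le
  | top => simp [EReal.coe_mul_top_of_pos (inv_pos.2 ha)] at h
  | coe y =>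
    norm_cast at h ⊢
    rwa [inv_mul_le_iff₀ ha] at h

/-- Pointwise truncation bound: either `x ≤ exp s`, or `x` is dominated by its `α`-th power. -/
theorem le_exp_add_mul_rpow {α : ℝ} (hα : 1 < α) (s : ℝ) (x : ENNReal) :
    x ≤ ENNReal.ofReal (exp s) + ENNReal.ofReal (exp (-((α - 1) * s))) * x ^ α := by
  rcases le_total x (ENNReal.ofReal (exp s)) with hx | hx
  · exact hx.trans le_self_add
  refine le_add_left ?_
  have hα' : 0 ≤ α - 1 := by linarith
  have hone : ENNReal.ofReal (exp (-((α - 1) * s))) * ENNReal.ofReal (exp s) ^ (α - 1) = 1 := by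
    rw [ENNReal.ofReal_rpow_of_pos (exp_pos s), ← exp_mul, ← ENNReal.ofReal_mul (exp_pos _).le,
      ← exp_add, mul_comm s, neg_add_cancel, exp_zero, ENNReal.ofReal_one]
  calc x = ENNReal.ofReal (exp (-((α - 1) * s))) * ENNReal.ofReal (exp s) ^ (α - 1) * x := by
        rw [hone, one_mul]
    _ ≤ ENNReal.ofReal (exp (-((α - 1) * s))) * x ^ (α - 1) * x := by gcongr
    _ = ENNReal.ofReal (exp (-((α - 1) * s))) * x ^ α := by
        rw [mul_assoc]
        nth_rewrite 2 [← ENNReal.rpow_one x]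
        rw [← ENNReal.rpow_add_of_nonneg _ _ hα' zero_le_one, sub_add_cancel]

/-- Measure bound via the `α`-moment of the density. -/
theorem measure_le_exp_mul_add_lintegral_rnDeriv_rpow {Ω : Type*} [MeasurableSpace Ω]
    {μ ν : Measure Ω} [μ.HaveLebesgueDecomposition ν] [SFinite ν] (hμν : μ ≪ ν)
    {α : ℝ} (hα : 1 < α) (s : ℝ) (R : Set Ω) :
    μ R ≤ ENNReal.ofReal (exp s) * ν R +
      ENNReal.ofReal (exp (-((α - 1) * s))) * ∫⁻ x, (μ.rnDeriv ν x) ^ α ∂ν := by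
  rw [← Measure.setLIntegral_rnDeriv hμν]
  calc ∫⁻ x in R, μ.rnDeriv ν x ∂ν
      ≤ ∫⁻ x in R, (ENNReal.ofReal (exp s) +
          ENNReal.ofReal (exp (-((α - 1) * s))) * (μ.rnDeriv ν x) ^ α) ∂ν :=
        lintegral_mono fun x => le_exp_add_mul_rpow hα s _
    _ = ENNReal.ofReal (exp s) * ν R +
          ENNReal.ofReal (exp (-((α - 1) * s))) * ∫⁻ x in R, (μ.rnDeriv ν x) ^ α ∂ν := by
        rw [lintegral_add_left measurable_const, setLIntegral_const,
          lintegral_const_mul' _ _ ENNReal.ofReal_ne_top]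
    _ ≤ _ := by
        gcongr
        exact Measure.restrict_le_self

/-- Rényi-DP to approximate-DP conversion for a mechanism: if `M` satisfies
`(α, ε)`-Rényi differential privacy w.r.t. adjacency `adj`, then for every `0 < δ < 1`
it satisfies `(ε + log(1/δ)/(α-1), δ)`-differential privacy. -/
theorem renyiDP_to_approxDP {D : Type*} {Ω : Type*} [MeasurableSpace Ω]
    (adj : D → D → Prop) (M : D → Measure Ω) [∀ d, IsProbabilityMeasure (M d)]
    {α ε : ℝ} (hα : 1 < α) (hε : 0 ≤ ε)
    (hRDP : ∀ d d', adj d d' → renyiDiv α (M d) (M d') ≤ (ε : EReal)) :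
    ∀ δ : ℝ, 0 < δ → δ < 1 →
      ∀ d d', adj d d' → ∀ R : Set Ω, MeasurableSet R →
        M d R ≤ ENNReal.ofReal (Real.exp (ε + Real.log (1 / δ) / (α - 1))) * M d' R
          + ENNReal.ofReal δ := by
  intro δ hδ _ d d' hadj R _
  have h := hRDP d d' hadj
  have hα' : 0 < α - 1 := sub_pos.2 hα
  have hac : M d ≪ M d' := by
    by_contra hac
    simp [renyiDiv, hac] at h
  rw [renyiDiv, if_pos hac] at h
  refine (measure_le_exp_mul_add_lintegral_rnDeriv_rpow hac hα
    (ε + log (1 / δ) / (α - 1)) R).trans ?_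
  gcongr
  refine (mul_le_mul_right (le_ofReal_exp_of_inv_mul_log_le hα' h) _).trans_eq ?_
  rw [← ENNReal.ofReal_mul (exp_pos _).le, ← exp_add]
  congr 1
  rw [mul_add, mul_div_cancel₀ _ hα'.ne', one_div, log_inv]
  ring_nf
  exact exp_log hδ
end

section
/- Let D be a type of datasets equipped with an adjacency relation ~, let Ω₁, …, Ω_k be measurable spaces, and for each i ≤ k let M_i : D → (probability measures on Ω_i) be a mechanism satisfying (α, ε_i)-Rényi differential privacy for a fixed α > 1. Then the non-adaptive composed mechanism M : D ↦ M₁(D) ⊗ ⋯ ⊗ M_k(D), a mechanism into probability measures on Ω₁ × ⋯ × Ω_k, satisfies (α, ε₁ + ⋯ + ε_k)-Rényi differential privacy. -/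
open MeasureTheory Real

theorem lintegral_pi_prod {ι : Type*} [Fintype ι] {Ω : ι → Type*} [∀ i, MeasurableSpace (Ω i)]
    (ν : ∀ i, Measure (Ω i)) [∀ i, IsProbabilityMeasure (ν i)] {f : ∀ i, Ω i → ENNReal}
    (hf : ∀ i, Measurable (f i)) :
    ∫⁻ x, ∏ i, f i (x i) ∂Measure.pi ν = ∏ i, ∫⁻ y, f i y ∂ν i := by
  refine (ProbabilityTheory.lintegral_prod_eq_prod_lintegral_of_indepFun Finset.univ
    (fun i (x : ∀ i, Ω i) ↦ f i (x i))
    (ProbabilityTheory.iIndepFun_pi fun i ↦ (hf i).aemeasurable)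
    fun i ↦ (hf i).comp (measurable_pi_apply i)).trans ?_
  exact Finset.prod_congr rfl fun i _ ↦ (measurePreserving_eval ν i).lintegral_comp (hf i)

theorem pi_withDensity {ι : Type*} [Fintype ι] {Ω : ι → Type*} [∀ i, MeasurableSpace (Ω i)]
    (ν : ∀ i, Measure (Ω i)) [∀ i, IsProbabilityMeasure (ν i)] {f : ∀ i, Ω i → ENNReal}
    (hf : ∀ i, Measurable (f i)) [∀ i, SigmaFinite ((ν i).withDensity (f i))] :
    Measure.pi (fun i ↦ (ν i).withDensity (f i)) =
      (Measure.pi ν).withDensity fun x ↦ ∏ i, f i (x i) := by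
  classical
  refine Measure.pi_eq fun s hs ↦ ?_
  rw [withDensity_apply _ (.univ_pi hs), ← lintegral_indicator (.univ_pi hs)]
  simp_rw [withDensity_apply _ (hs _), ← lintegral_indicator (hs _)]
  rw [← lintegral_pi_prod ν fun i ↦ (hf i).indicator (hs i)]
  congr 1 with x
  simp [Set.indicator_apply, Finset.prod_ite_zero]

theorem absolutelyContinuous_pi_and_rnDeriv_pi {ι : Type*} [Fintype ι] {Ω : ι → Type*}
    [∀ i, MeasurableSpace (Ω i)] (μ ν : ∀ i, Measure (Ω i)) [∀ i, SigmaFinite (μ i)]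
    [∀ i, IsProbabilityMeasure (ν i)] (h : ∀ i, μ i ≪ ν i) :
    Measure.pi μ ≪ Measure.pi ν ∧
      (Measure.pi μ).rnDeriv (Measure.pi ν) =ᵐ[Measure.pi ν]
        fun x ↦ ∏ i, (μ i).rnDeriv (ν i) (x i) := by
  have hμ i : (ν i).withDensity ((μ i).rnDeriv (ν i)) = μ i :=
    Measure.withDensity_rnDeriv_eq _ _ (h i)
  have hσ : ∀ i, SigmaFinite ((ν i).withDensity ((μ i).rnDeriv (ν i))) := fun i ↦ by
    rw [hμ i]; infer_instance
  have key := pi_withDensity ν fun i ↦ Measure.measurable_rnDeriv (μ i) (ν i)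
  simp_rw [hμ] at key
  rw [key]
  exact ⟨withDensity_absolutelyContinuous _ _,
    Measure.rnDeriv_withDensity _ (by fun_prop)⟩

theorem ENNReal.log_prod {ι : Type*} (s : Finset ι) (f : ι → ENNReal) :
    ENNReal.log (∏ i ∈ s, f i) = ∑ i ∈ s, ENNReal.log (f i) := by
  classical
  induction s using Finset.induction_on with
  | empty => simp
  | insert a s ha ih => rw [Finset.prod_insert ha, Finset.sum_insert ha, ENNReal.log_mul_add, ih]

theorem EReal.coe_mul_sum_of_nonneg {ι : Type*} (s : Finset ι) {c : ℝ} (hc : 0 ≤ c)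
    (f : ι → EReal) : (c : EReal) * ∑ i ∈ s, f i = ∑ i ∈ s, (c : EReal) * f i := by
  classical
  induction s using Finset.induction_on with
  | empty => simp
  | insert a s ha ih =>
    rw [Finset.sum_insert ha, Finset.sum_insert ha, ← ih,
      EReal.left_distrib_of_nonneg_of_ne_top (EReal.coe_nonneg.2 hc) (EReal.coe_ne_top c)]

theorem EReal.coe_sum {ι : Type*} (s : Finset ι) (f : ι → ℝ) :
    ((∑ i ∈ s, f i : ℝ) : EReal) = ∑ i ∈ s, (f i : EReal) :=
  map_sum (⟨⟨Real.toEReal, EReal.coe_zero⟩, EReal.coe_add⟩ : ℝ →+ EReal) f s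

/-- Rényi divergence is additive over products. -/
theorem renyiDiv_pi {ι : Type*} [Fintype ι] {Ω : ι → Type*} [∀ i, MeasurableSpace (Ω i)]
    {α : ℝ} (hα : 1 ≤ α) (μ ν : ∀ i, Measure (Ω i)) [∀ i, SigmaFinite (μ i)]
    [∀ i, IsProbabilityMeasure (ν i)] (h : ∀ i, μ i ≪ ν i) :
    renyiDiv α (Measure.pi μ) (Measure.pi ν) = ∑ i, renyiDiv α (μ i) (ν i) := by
  obtain ⟨hac, hd⟩ := absolutelyContinuous_pi_and_rnDeriv_pi μ ν h
  have hint : ∫⁻ x, (Measure.pi μ).rnDeriv (Measure.pi ν) x ^ α ∂Measure.pi ν =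
      ∏ i, ∫⁻ y, (μ i).rnDeriv (ν i) y ^ α ∂ν i := by
    rw [← lintegral_pi_prod ν fun i ↦ (Measure.measurable_rnDeriv (μ i) (ν i)).pow_const α]
    refine lintegral_congr_ae ?_
    filter_upwards [hd] with x hx
    rw [hx, ENNReal.prod_rpow_of_nonneg (by linarith)]
  simp only [renyiDiv, if_pos hac, if_pos (h _), hint, ENNReal.log_prod]
  exact EReal.coe_mul_sum_of_nonneg _ (inv_nonneg.2 (by linarith)) _

theorem absolutelyContinuous_of_renyiDiv_ne_top {Ω : Type*} [MeasurableSpace Ω] {α : ℝ}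
    {μ ν : Measure Ω} (h : renyiDiv α μ ν ≠ ⊤) : μ ≪ ν := by
  by_contra hac
  exact h (if_neg hac)

/-- Non-adaptive composition for Rényi differential privacy: if each mechanism
`M i` satisfies `(α, ε i)`-Rényi DP w.r.t. adjacency `adj`, then the product mechanism
`d ↦ ⨂ i, M i d` satisfies `(α, ∑ i, ε i)`-Rényi DP. -/
theorem renyiDP_composition {D : Type*} {k : ℕ} {Ω : Fin k → Type*}
    [∀ i, MeasurableSpace (Ω i)] (adj : D → D → Prop)
    (M : ∀ i, D → Measure (Ω i)) [∀ i d, IsProbabilityMeasure (M i d)]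
    {α : ℝ} (hα : 1 < α) (ε : Fin k → ℝ)
    (hRDP : ∀ i, ∀ d d', adj d d' → renyiDiv α (M i d) (M i d') ≤ ((ε i : ℝ) : EReal)) :
    ∀ d d', adj d d' →
      renyiDiv α (Measure.pi (fun i => M i d)) (Measure.pi (fun i => M i d'))
        ≤ ((∑ i, ε i : ℝ) : EReal) := by
  intro d d' hd
  have hac i : M i d ≪ M i d' := absolutelyContinuous_of_renyiDiv_ne_top
    ((hRDP i d d' hd).trans_lt (EReal.coe_lt_top _)).ne
  rw [renyiDiv_pi hα.le _ _ hac, EReal.coe_sum]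
  exact Finset.sum_le_sum fun i _ ↦ hRDP i d d' hd
end
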